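/- For each Δ ≥ 2 there is a simple undirected graph G = (V,E) of maximum degree at most Δ, a port numbering p of G and nodes v, u, w ∈ V with {v,u} ∈ E and {v,w} ∈ E, such that for every distributed state machine A in class SV, in the execution of A in (G,p) with the trivial input, the message that v receives from u equals the message that v receives from w in every round r = 1, 2, ..., 2Δ−2; that is, if p(u,j) = (v,i) and p(w,j') = (v,i'), then a_r(v,i) = a_r(v,i') for all r = 1,...,2Δ−2. -/

import Mathlib

namespace Paper

/-- The degree of a vertex: the number of its neighbours. -/
noncomputable def deg {V : Type} (G : SimpleGraph V) (v : V) : ℕ :=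
  {u | G.Adj v u}.ncard

/-- A port numbering of a graph, modelled as a partial map sending each
output port `(v, i)` with `1 ≤ i ≤ deg v` to an input port `(u, j)` of an
adjacent node `u`, bijectively, such that there is a port between `v` and `u`
if and only if they are adjacent. -/
structure IsPortNumbering {V : Type} (G : SimpleGraph V)
    (pn : V → ℕ → Option (V × ℕ)) : Prop where
  dom : ∀ v i, (pn v i).isSome ↔ 1 ≤ i ∧ i ≤ deg G v
  adj : ∀ v i u j, pn v i = some (u, j) → G.Adj v u ∧ 1 ≤ j ∧ j ≤ deg G u
  bij : ∀ u j, 1 ≤ j → j ≤ deg G u → ∃! vi : V × ℕ, pn vi.1 vi.2 = some (u, j)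
  edge : ∀ v u, G.Adj v u ↔ ∃ i j, pn v i = some (u, j)

/-- A generalised port numbering with port numbers from an arbitrary set `N`:
each node `v` has a set of `deg v` output port numbers (those `o` with
`pn v o ≠ none`) and a set of `deg v` input port numbers (those `i` received
from some output port), and `pn` is a bijection from output ports to input
ports of adjacent nodes. -/
structure IsGenPortNumbering {V N : Type} (G : SimpleGraph V)
    (pn : V → N → Option (V × N)) : Prop where
  adj : ∀ v o u i, pn v o = some (u, i) → G.Adj v u
  edge : ∀ v u, G.Adj v u → ∃ o i, pn v o = some (u, i)
  inj : ∀ v o v' o' u i, pn v o = some (u, i) → pn v' o' = some (u, i) →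
    v = v' ∧ o = o'
  out_card : ∀ v, {o | (pn v o).isSome}.ncard = deg G v
  in_card : ∀ u, {i | ∃ v o, pn v o = some (u, i)}.ncard = deg G u

/-- `r`-SV-bisimilarity of `(G, f, v, p)` and `(G', f', v', p')`. -/
def SVBisim {V V' X N : Type} (G : SimpleGraph V) (G' : SimpleGraph V')
    (f : V → X) (f' : V' → X)
    (p : V → N → Option (V × N)) (p' : V' → N → Option (V' × N)) :
    ℕ → V → V' → Prop
  | 0, v, v' => deg G v = deg G' v' ∧ f v = f' v'
  | r + 1, v, v' =>
      (deg G v = deg G' v' ∧ f v = f' v') ∧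
      (∀ w, G.Adj v w → ∃ w', G'.Adj v' w' ∧
        SVBisim G G' f f' p p' r w w' ∧
        ∃ a b c, p w a = some (v, b) ∧ p' w' a = some (v', c)) ∧
      (∀ w', G'.Adj v' w' → ∃ w, G.Adj v w ∧
        SVBisim G G' f f' p p' r w w' ∧
        ∃ a b c, p w a = some (v, b) ∧ p' w' a = some (v', c))

/-- A distributed state machine for `(F(Δ), X)`: a set of states `Y`,
a finite set `Z` of stopping states, an initialisation function, a message
set `M` with a special symbol `eps` ("no message"), a message-construction
function `msg` and a transition function `trans`. -/
structure DSM (Δ : ℕ) (X : Type) where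
  Y : Type
  Z : Set Y
  Zfin : Z.Finite
  init : ℕ → X → Y
  M : Type
  eps : M
  msg : Y → ℕ → M
  trans : Y → (Fin Δ → M) → Y
  halt_msg : ∀ z ∈ Z, ∀ i, msg z i = eps
  halt_trans : ∀ z ∈ Z, ∀ m, trans z m = z

/-- Class `SV`: the state transitions are invariant under the set of the
received message vector. -/
def DSM.InSV {Δ : ℕ} {X : Type} (A : DSM Δ X) : Prop :=
  ∀ (y : A.Y) (a b : Fin Δ → A.M),
    Set.range a = Set.range b → A.trans y a = A.trans y b

/-- Class `MV`: the state transitions are invariant under the multiset of the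
received message vector. -/
def DSM.InMV {Δ : ℕ} {X : Type} (A : DSM Δ X) : Prop :=
  ∀ (y : A.Y) (a b : Fin Δ → A.M),
    (↑(List.ofFn a) : Multiset A.M) = ↑(List.ofFn b) →
      A.trans y a = A.trans y b

open Classical in
/-- The message received by node `v` through its input port `i + 1` when the
nodes are in states `x`: if the port numbering connects some output port
`(u, j)` to `(v, i + 1)`, it is `msg (x u) j`, and otherwise the padding
symbol `eps`. -/
noncomputable def recv {V X : Type} {Δ : ℕ} (A : DSM Δ X)
    (pn : V → ℕ → Option (V × ℕ)) (x : V → A.Y) (v : V) (i : Fin Δ) : A.M :=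
  if h : ∃ uj : V × ℕ, pn uj.1 uj.2 = some (v, (i : ℕ) + 1) then
    A.msg (x h.choose.1) h.choose.2
  else A.eps

/-- `run A G f pn r v` is the state of node `v` in round `r` of the execution
of `A` in `(G, f, pn)`. -/
noncomputable def run {V X : Type} {Δ : ℕ} (A : DSM Δ X) (G : SimpleGraph V)
    (f : V → X) (pn : V → ℕ → Option (V × ℕ)) : ℕ → V → A.Y
  | 0, v => A.init (deg G v) (f v)
  | r + 1, v => A.trans (run A G f pn r v) (fun i => recv A pn (run A G f pn r) v i)

/-! ### Construction: an infinite `Δ`-regular tree with a graded labelling -/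

/-- Local description of a node of the tree: its side `k`, its level `e`, the label `o` of its
output port towards the parent and the output label `i` of the parent towards it. -/
structure St where
  k : Bool
  e : ℕ
  o : ℕ
  i : ℕ

/-- The label under which a node in state `s` receives messages from its `c`-th neighbour. -/
def inl (s : St) (c : ℕ) : ℕ :=
  if s.k then (if c - 1 = s.o - 1 then s.i else if c - 1 = s.i then s.o - 1 else c - 1)
  else (if c = s.o then s.i else if c = s.i then s.o else c)

/-- State of the `c`-th neighbour (a child). -/
def step (s : St) (c : ℕ) : St :=
  ⟨!s.k, if s.k then max s.e (c - 1) else max (s.e + 1) c, inl s c, c⟩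

def stL (r : Bool) : List ℕ → St
  | [] => ⟨r, 0, 0, 0⟩
  | c :: l => step (stL r l) c

def okL (Δ : ℕ) (r : Bool) : List ℕ → Prop
  | [] => True
  | c :: l => okL Δ r l ∧ c < Δ ∧ c ≠ (stL r l).o

def Nd (Δ : ℕ) : Type := {x : Bool × List ℕ // okL Δ x.1 x.2}

def Nd.st {Δ : ℕ} (x : Nd Δ) : St := stL x.1.1 x.1.2

def Nd.child {Δ : ℕ} (x : Nd Δ) (c : ℕ) (h : c < Δ ∧ c ≠ x.st.o) : Nd Δ :=
  ⟨(x.1.1, c :: x.1.2), x.2, h.1, h.2⟩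

def Nd.par {Δ : ℕ} : Nd Δ → Nd Δ
  | ⟨(r, []), _⟩ => ⟨(!r, []), trivial⟩
  | ⟨(r, _ :: l), h⟩ => ⟨(r, l), h.1⟩

def Nd.nb {Δ : ℕ} (x : Nd Δ) (c : ℕ) : Nd Δ :=
  if h : c < Δ ∧ c ≠ x.st.o then x.child c h else x.par

structure Good (Δ : ℕ) (s : St) : Prop where
  oΔ : s.o < Δ
  iΔ : s.i < Δ
  hV : s.k = true → s.o ≤ s.e + 1 ∧ s.i ≤ s.e
  hU : s.k = false → s.o ≤ s.e ∧ s.i ≤ s.e + 1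

lemma inl_o (s : St) : inl s s.o = s.i := by
  unfold inl; split <;> simp

lemma inl_lt {Δ : ℕ} {s : St} (h : Good Δ s) {c : ℕ} (hc : c < Δ) : inl s c < Δ := by
  have := h.oΔ
  have := h.iΔ
  unfold inl; split_ifs <;> omega

lemma good_step {Δ : ℕ} {s : St} (h : Good Δ s) {c : ℕ} (hc : c < Δ) : Good Δ (step s c) := by
  obtain ⟨k, e, o, i⟩ := s
  have h3 := h.hV
  have h4 := h.hU
  refine ⟨inl_lt h hc, hc, ?_, ?_⟩
  · intro hk
    have hk : k = false := by simpa [step] using hk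
    subst hk
    simp only [step, inl] at *
    simp at h4
    simp
    split_ifs <;> omega
  · intro hk
    have hk : k = true := by simpa [step] using hk
    subst hk
    simp only [step, inl] at *
    simp at h3
    simp
    split_ifs <;> omega

lemma good_stL {Δ : ℕ} (hΔ : 2 ≤ Δ) (r : Bool) : ∀ l, okL Δ r l → Good Δ (stL r l)
  | [], _ => ⟨by simp [stL]; omega, by simp [stL]; omega, by simp [stL], by simp [stL]⟩
  | _ :: l, h => good_step (good_stL hΔ r l h.1) h.2.1

lemma good {Δ : ℕ} (hΔ : 2 ≤ Δ) (x : Nd Δ) : Good Δ x.st := good_stL hΔ _ _ x.2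

lemma st_child {Δ : ℕ} (x : Nd Δ) (c : ℕ) (h) : (x.child c h).st = step x.st c := rfl

lemma par_child {Δ : ℕ} (x : Nd Δ) (c : ℕ) (h) : (x.child c h).par = x := rfl

/-- Facts about the parent. -/
lemma par_facts {Δ : ℕ} (x : Nd Δ) :
    x.par.st.k = !x.st.k ∧ x.par.st.e ≤ x.st.e ∧ x.par.nb x.st.i = x ∧
      inl x.par.st x.st.i = x.st.o := by
  obtain ⟨⟨r, l⟩, h⟩ := x
  cases l with
  | nil =>
    refine ⟨rfl, le_rfl, ?_, ?_⟩
    · simp [Nd.nb, Nd.st, stL, Nd.par]; rfl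
    · simp [Nd.st, stL, Nd.par, inl]
  | cons c l =>
    refine ⟨?_, ?_, ?_, rfl⟩
    · simp [Nd.st, stL, Nd.par, step]
    · simp only [Nd.st, stL, Nd.par, step]; split <;> omega
    · have : c < Δ ∧ c ≠ (stL r l).o := h.2
      simp [Nd.nb, Nd.st, stL, Nd.par, step, this, Nd.child]; rfl

lemma nb_o {Δ : ℕ} (x : Nd Δ) : x.nb x.st.o = x.par := by simp [Nd.nb]

lemma nb_k {Δ : ℕ} (x : Nd Δ) (c : ℕ) : (x.nb c).st.k = !x.st.k := by
  unfold Nd.nb; split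
  · rfl
  · exact (par_facts x).1

lemma rev {Δ : ℕ} (x : Nd Δ) (c : ℕ) (hc : c < Δ) :
    (x.nb c).nb (inl x.st c) = x ∧ inl (x.nb c).st (inl x.st c) = c := by
  by_cases h : c = x.st.o
  · subst h
    rw [nb_o, inl_o]
    exact (par_facts x).2.2
  · have e : x.nb c = x.child c ⟨hc, h⟩ := by simp [Nd.nb, hc, h]
    rw [e]
    have e2 : inl x.st c = (x.child c ⟨hc, h⟩).st.o := rfl
    rw [e2, nb_o, inl_o]
    exact ⟨rfl, rfl⟩

lemma child_ne_par {Δ : ℕ} (x : Nd Δ) (c h) : x.child c h ≠ x.par := by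
  obtain ⟨⟨r, l⟩, hx⟩ := x
  intro e
  have e' := congrArg (fun y : Nd Δ => y.1.2.length) e
  cases l <;> simp [Nd.child, Nd.par] at e'
  omega

lemma nb_inj {Δ : ℕ} (x : Nd Δ) {c d : ℕ} (hc : c < Δ) (hd : d < Δ) (h : x.nb c = x.nb d) :
    c = d := by
  unfold Nd.nb at h
  split at h <;> split at h
  · have e' := congrArg (fun y : Nd Δ => y.1.2) h
    simp [Nd.child] at e'
    exact e'
  · exact absurd h (child_ne_par _ _ _)
  · exact absurd h.symm (child_ne_par _ _ _)
  · simp_all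

def TG {Δ : ℕ} (hΔ : 2 ≤ Δ) : SimpleGraph (Nd Δ) where
  Adj x y := ∃ c < Δ, x.nb c = y
  symm := ⟨by
    rintro x y ⟨c, hc, rfl⟩
    exact ⟨_, inl_lt (good hΔ x) hc, (rev x c hc).1⟩⟩
  loopless := ⟨by
    rintro x ⟨c, hc, h⟩
    have := nb_k x c
    rw [h] at this
    simp at this⟩

lemma deg_TG {Δ : ℕ} (hΔ : 2 ≤ Δ) (x : Nd Δ) : deg (TG hΔ) x = Δ := by
  have : {u | (TG hΔ).Adj x u} = x.nb '' (Set.Iio Δ) := by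
    ext u; simp [TG]
  rw [deg, this, Set.ncard_image_of_injOn]
  · simp [Set.ncard_eq_toFinset_card']
  · intro c hc d hd h
    exact nb_inj x hc hd h

def TP (Δ : ℕ) (x : Nd Δ) (i : ℕ) : Option (Nd Δ × ℕ) :=
  if 1 ≤ i ∧ i ≤ Δ then some (x.nb (i - 1), inl x.st (i - 1) + 1) else none

lemma TP_eq {Δ : ℕ} (x y : Nd Δ) (i j : ℕ) : TP Δ x i = some (y, j) ↔
    ∃ c < Δ, i = c + 1 ∧ x.nb c = y ∧ j = inl x.st c + 1 := by
  unfold TP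
  constructor
  · intro h
    split at h
    · simp at h
      exact ⟨i - 1, by omega, by omega, h.1, h.2.symm⟩
    · simp at h
  · rintro ⟨c, hc, rfl, rfl, rfl⟩
    simp; omega

lemma TP_rev {Δ : ℕ} (hΔ : 2 ≤ Δ) (x y : Nd Δ) (i c : ℕ) (hc : c < Δ) :
    TP Δ y i = some (x, c + 1) ↔ y = x.nb c ∧ i = inl x.st c + 1 := by
  rw [TP_eq]
  constructor
  · rintro ⟨d, hd, rfl, rfl, h⟩
    have h : c = inl y.st d := by omega
    subst h
    rw [(rev y d hd).1, (rev y d hd).2]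
    exact ⟨rfl, rfl⟩
  · rintro ⟨rfl, rfl⟩
    exact ⟨_, inl_lt (good hΔ x) hc, rfl, (rev x c hc).1, by rw [(rev x c hc).2]⟩

lemma TP_port {Δ : ℕ} (hΔ : 2 ≤ Δ) : IsPortNumbering (TG hΔ) (TP Δ) where
  dom v i := by rw [deg_TG]; unfold TP; split <;> simp_all
  adj v i u j h := by
    rw [TP_eq] at h
    obtain ⟨c, hc, rfl, rfl, rfl⟩ := h
    rw [deg_TG]
    have := inl_lt (good hΔ v) hc
    exact ⟨⟨c, hc, rfl⟩, by omega, by omega⟩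
  bij u j h1 h2 := by
    rw [deg_TG] at h2
    obtain ⟨c, rfl⟩ : ∃ c, j = c + 1 := ⟨j - 1, by omega⟩
    refine ⟨(u.nb c, inl u.st c + 1), ?_, ?_⟩
    · exact (TP_rev hΔ _ _ _ _ (by omega)).2 ⟨rfl, rfl⟩
    · rintro ⟨v, i⟩ h
      have := (TP_rev hΔ _ _ _ _ (by omega)).1 h
      exact Prod.ext this.1 this.2
  edge v u := by
    constructor
    · rintro ⟨c, hc, rfl⟩
      exact ⟨c + 1, _, (TP_eq _ _ _ _).2 ⟨c, hc, rfl, rfl, rfl⟩⟩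
    · rintro ⟨i, j, h⟩
      obtain ⟨c, hc, -, h, -⟩ := (TP_eq _ _ _ _).1 h
      exact ⟨c, hc, h⟩

/-! ### Bisimilarity -/

def Half {Δ : ℕ} (R : Nd Δ → Nd Δ → Prop) (x y : Nd Δ) : Prop :=
  ∀ c < Δ, ∃ d < Δ, inl x.st c = inl y.st d ∧ R (x.nb c) (y.nb d)

def Sim {Δ : ℕ} : ℕ → Nd Δ → Nd Δ → Prop
  | 0, _, _ => True
  | n + 1, x, y => Sim n x y ∧ Half (Sim n) x y ∧ Half (Sim n) y x

lemma Sim.symm {Δ : ℕ} {n : ℕ} {x y : Nd Δ} (h : Sim n x y) : Sim n y x := by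
  cases n with
  | zero => trivial
  | succ n => exact ⟨h.1.symm, h.2.2, h.2.1⟩

lemma Sim.pred {Δ : ℕ} {n : ℕ} {x y : Nd Δ} (h : Sim n x y) : Sim (n - 1) x y := by
  cases n with
  | zero => trivial
  | succ n => exact h.1

lemma recv_TP {Δ : ℕ} (hΔ : 2 ≤ Δ) {X : Type} (A : DSM Δ X) (s : Nd Δ → A.Y) (x : Nd Δ)
    (c : Fin Δ) : recv A (TP Δ) s x c = A.msg (s (x.nb c)) (inl x.st c + 1) := by
  have hex : ∃ uj : Nd Δ × ℕ, TP Δ uj.1 uj.2 = some (x, (c : ℕ) + 1) :=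
    ⟨(x.nb c, inl x.st c + 1), (TP_rev hΔ _ _ _ _ c.2).2 ⟨rfl, rfl⟩⟩
  unfold recv
  rw [dif_pos hex]
  have := (TP_rev hΔ _ _ _ _ c.2).1 hex.choose_spec
  rw [this.1, this.2]

lemma sim_run {Δ : ℕ} (hΔ : 2 ≤ Δ) {X : Type} (x₀ : X) (A : DSM Δ X) (hA : A.InSV) (n : ℕ) :
    ∀ x y : Nd Δ, Sim n x y →
      run A (TG hΔ) (fun _ => x₀) (TP Δ) n x = run A (TG hΔ) (fun _ => x₀) (TP Δ) n y := by
  induction n with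
  | zero => intro x y _; simp [run, deg_TG]
  | succ n ih =>
    have key : ∀ x y : Nd Δ, Half (Sim n) x y →
        Set.range (fun i => recv A (TP Δ) (run A (TG hΔ) (fun _ => x₀) (TP Δ) n) x i) ⊆
        Set.range (fun i => recv A (TP Δ) (run A (TG hΔ) (fun _ => x₀) (TP Δ) n) y i) := by
      rintro x y h _ ⟨c, rfl⟩
      obtain ⟨d, hd, h1, h2⟩ := h c c.2
      refine ⟨⟨d, hd⟩, ?_⟩
      simp only [recv_TP hΔ]
      rw [h1, ih _ _ h2]
    intro x y h
    simp only [run]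
    rw [ih x y h.1]
    exact hA _ _ _ (Set.Subset.antisymm (key _ _ h.2.1) (key _ _ h.2.2))

lemma sim_same {Δ : ℕ} (n : ℕ) : ∀ x y : Nd Δ, x.st = y.st → Sim (n - 1) x.par y.par →
    Sim n x y := by
  induction n with
  | zero => intros; trivial
  | succ n ih =>
    have key : ∀ x y : Nd Δ, x.st = y.st → Sim n x.par y.par → Sim n x y →
        Half (Sim n) x y := by
      intro x y h hp hs c hc
      refine ⟨c, hc, by rw [h], ?_⟩
      unfold Nd.nb
      by_cases hco : c = x.st.o
      · rw [dif_neg (by simp [hco]), dif_neg (by simp [hco, h])]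
        exact hp
      · rw [dif_pos ⟨hc, hco⟩, dif_pos ⟨hc, by rwa [← h]⟩]
        apply ih
        · rw [st_child, st_child, h]
        · exact hs.pred
    intro x y h hp
    have hs : Sim n x y := ih x y h hp.pred
    exact ⟨hs, key x y h hp hs, key y x h.symm hp.symm hs.symm⟩

/-- Weighted level. -/
def St.D (s : St) : ℕ := if s.k then 2 * s.e else 2 * s.e + 1

lemma nbV {Δ : ℕ} (hΔ : 2 ≤ Δ) (x : Nd Δ) (hk : x.st.k = true) (c : ℕ) (hc : c < Δ) :
    (x.nb c).st.D ≤ 2 * max x.st.e (inl x.st c) + 1 := by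
  have hg := (good hΔ x).hV hk
  have hk' := nb_k x c
  have hp := (par_facts x).2.1
  unfold Nd.nb at hk' ⊢
  split_ifs at hk' ⊢ with h
  · rw [st_child]
    simp only [St.D, step, hk, inl]
    simp
    split_ifs <;> omega
  · simp only [St.D, hk', hk]
    simp
    omega

lemma nbU {Δ : ℕ} (hΔ : 2 ≤ Δ) (x : Nd Δ) (hk : x.st.k = false) (c : ℕ) (hc : c < Δ) :
    (x.nb c).st.D ≤ 2 * max (x.st.e + 1) (inl x.st c) := by
  have hg := (good hΔ x).hU hk
  have hk' := nb_k x c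
  have hp := (par_facts x).2.1
  unfold Nd.nb at hk' ⊢
  split_ifs at hk' ⊢ with h
  · rw [st_child]
    simp only [St.D, step, hk, inl]
    simp
    split_ifs <;> omega
  · simp only [St.D, hk', hk]
    simp
    omega

lemma bigV {Δ : ℕ} (hΔ : 2 ≤ Δ) (x : Nd Δ) (hk : x.st.k = true) (c : ℕ)
    (hi : x.st.e < inl x.st c) :
    c = inl x.st c + 1 ∧ c ≠ x.st.o ∧ step x.st c = ⟨false, inl x.st c, inl x.st c, c⟩ := by
  have hg := (good hΔ x).hV hk
  have h1 : c = inl x.st c + 1 := by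
    revert hi
    simp only [inl, hk]
    simp
    split_ifs <;> omega
  refine ⟨h1, by omega, ?_⟩
  simp only [step, hk]
  simp
  omega

lemma bigV' {Δ : ℕ} (hΔ : 2 ≤ Δ) (x : Nd Δ) (hk : x.st.k = true) (k : ℕ)
    (hi : x.st.e < k) : inl x.st (k + 1) = k := by
  have hg := (good hΔ x).hV hk
  simp only [inl, hk]
  simp
  split_ifs <;> omega

lemma bigU {Δ : ℕ} (hΔ : 2 ≤ Δ) (x : Nd Δ) (hk : x.st.k = false) (c : ℕ)
    (hi : x.st.e + 1 < inl x.st c) :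
    c = inl x.st c ∧ c ≠ x.st.o ∧ step x.st c = ⟨true, c, c, c⟩ := by
  have hg := (good hΔ x).hU hk
  have h1 : c = inl x.st c := by
    revert hi
    simp only [inl, hk]
    simp
    split_ifs <;> omega
  refine ⟨h1, by omega, ?_⟩
  simp only [step, hk]
  simp
  omega

lemma bigU' {Δ : ℕ} (hΔ : 2 ≤ Δ) (x : Nd Δ) (hk : x.st.k = false) (k : ℕ)
    (hi : x.st.e + 1 < k) : inl x.st k = k := by
  have hg := (good hΔ x).hU hk
  simp only [inl, hk]
  simp
  split_ifs <;> omega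

lemma surjV {Δ : ℕ} (hΔ : 2 ≤ Δ) (x : Nd Δ) (hk : x.st.k = true) (he : x.st.e + 2 ≤ Δ)
    (k : ℕ) (h : k + 2 ≤ Δ) :
    ∃ d < Δ, inl x.st d = k := by
  have hg := good hΔ x
  have h1 := hg.oΔ
  have h2 := hg.iΔ
  by_cases h3 : k = x.st.i
  · exact ⟨x.st.o, h1, by rw [inl_o, h3]⟩
  by_cases h4 : k = x.st.o - 1
  · by_cases h5 : x.st.i + 1 < Δ
    · refine ⟨x.st.i + 1, h5, ?_⟩
      simp only [inl, hk]; simp; split_ifs <;> omega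
    · have := hg.hV hk
      omega
  · refine ⟨k + 1, by omega, ?_⟩
    simp only [inl, hk]; simp; split_ifs <;> omega

lemma inlV_lt {Δ : ℕ} (hΔ : 2 ≤ Δ) (x : Nd Δ) (hk : x.st.k = true) (he : x.st.e + 2 ≤ Δ)
    (c : ℕ) (hc : c < Δ) : inl x.st c + 2 ≤ Δ := by
  have hg := (good hΔ x).hV hk
  simp only [inl, hk]; simp; split_ifs <;> omega

lemma surjU {Δ : ℕ} (hΔ : 2 ≤ Δ) (x : Nd Δ) (hk : x.st.k = false) (k : ℕ) (h : k < Δ) :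
    ∃ d < Δ, inl x.st d = k := by
  refine ⟨inl x.st k, inl_lt (good hΔ x) h, ?_⟩
  simp only [inl, hk]; simp; split_ifs <;> omega

lemma main_sim {Δ : ℕ} (hΔ : 2 ≤ Δ) (n : ℕ) : ∀ x y : Nd Δ, x.st.k = y.st.k →
    n + x.st.D ≤ 2 * Δ - 2 → n + y.st.D ≤ 2 * Δ - 2 → Sim n x y := by
  induction n with
  | zero => intros; trivial
  | succ n ih =>
    have key : ∀ x y : Nd Δ, x.st.k = y.st.k →
        n + 1 + x.st.D ≤ 2 * Δ - 2 → n + 1 + y.st.D ≤ 2 * Δ - 2 → Half (Sim n) x y := by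
      intro x y hk hx hy c hc
      have hxy : Sim n x y := ih x y hk (by omega) (by omega)
      cases hkx : x.st.k with
      | true =>
        have hky : y.st.k = true := by rw [← hk, hkx]
        simp only [St.D, hkx, hky, if_true] at hx hy
        have hlt := inlV_lt hΔ x hkx (by omega) c hc
        by_cases hb : x.st.e < inl x.st c ∧ y.st.e < inl x.st c
        · obtain ⟨e1, e2, e3⟩ := bigV hΔ x hkx c hb.1
          have e4 := bigV' hΔ y hky _ hb.2
          rw [← e1] at e4
          obtain ⟨-, e5, e6⟩ := bigV hΔ y hky c (by rw [e4]; exact hb.2)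
          refine ⟨c, hc, e4.symm, ?_⟩
          unfold Nd.nb
          rw [dif_pos ⟨hc, e2⟩, dif_pos ⟨hc, e5⟩]
          apply sim_same
          · rw [st_child, st_child, e3, e6, e4]
          · exact hxy.pred
        · obtain ⟨d, hd, e⟩ := surjV hΔ y hky (by omega) _ hlt
          refine ⟨d, hd, e.symm, ?_⟩
          have b1 := nbV hΔ x hkx c hc
          have b2 := nbV hΔ y hky d hd
          rw [e] at b2
          exact ih _ _ (by rw [nb_k, nb_k, hk]) (by omega) (by omega)
      | false =>
        have hky : y.st.k = false := by rw [← hk, hkx]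
        simp [St.D, hkx, hky] at hx hy
        have hlt := inl_lt (good hΔ x) hc
        by_cases hb : x.st.e + 1 < inl x.st c ∧ y.st.e + 1 < inl x.st c
        · obtain ⟨e1, e2, e3⟩ := bigU hΔ x hkx c hb.1
          have e4 := bigU' hΔ y hky _ hb.2
          rw [← e1] at e4
          obtain ⟨-, e5, e6⟩ := bigU hΔ y hky c (by rw [e4]; omega)
          refine ⟨c, hc, by rw [e4, ← e1], ?_⟩
          unfold Nd.nb
          rw [dif_pos ⟨hc, e2⟩, dif_pos ⟨hc, e5⟩]
          apply sim_same
          · rw [st_child, st_child, e3, e6]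
          · exact hxy.pred
        · obtain ⟨d, hd, e⟩ := surjU hΔ y hky _ hlt
          refine ⟨d, hd, e.symm, ?_⟩
          have b1 := nbU hΔ x hkx c hc
          have b2 := nbU hΔ y hky d hd
          rw [e] at b2
          exact ih _ _ (by rw [nb_k, nb_k, hk]) (by omega) (by omega)
    intro x y hk hx hy
    exact ⟨ih x y hk (by omega) (by omega), key x y hk hx hy, key y x hk.symm hy hx⟩

/-- For each `Δ ≥ 2` there is a graph of maximum degree at most `Δ`, a port
numbering `p` and nodes `v, u, w` with `{v,u}, {v,w} ∈ E`, such that when any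
algorithm `A ∈ SV` is executed in `(G, p)` (with the trivial input), node `v`
receives identical messages from `u` and `w` in rounds `1, 2, …, 2Δ−2`:
the message `μ(x_r(u), j)` sent by `u` to `v` equals the message
`μ(x_r(w), j')` sent by `w` to `v` for all `r = 0, 1, …, 2Δ−3`. -/
theorem simulation_lower_bound (Δ : ℕ) (hΔ : 2 ≤ Δ) :
    ∃ (V : Type) (G : SimpleGraph V) (pn : V → ℕ → Option (V × ℕ))
      (v u w : V),
      (∀ z, deg G z ≤ Δ) ∧ IsPortNumbering G pn ∧
      G.Adj v u ∧ G.Adj v w ∧ u ≠ w ∧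
      ∀ (X : Type) (x₀ : X) (A : DSM Δ X), A.InSV →
        ∀ j i j' i' : ℕ, pn u j = some (v, i) → pn w j' = some (v, i') →
          ∀ r ≤ 2 * Δ - 3,
            A.msg (run A G (fun _ => x₀) pn r u) j =
              A.msg (run A G (fun _ => x₀) pn r w) j' := by
  let v : Nd Δ := ⟨(true, []), trivial⟩
  have h0 : (0 : ℕ) < Δ := by omega
  have h1 : (1 : ℕ) < Δ := by omega
  have hi0 : inl v.st 0 = 0 := by simp [v, Nd.st, stL, inl]
  have hi1 : inl v.st 1 = 0 := by simp [v, Nd.st, stL, inl]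
  have hne : v.nb 0 ≠ v.nb 1 := fun h => by simpa using nb_inj v h0 h1 h
  have out : ∀ c < Δ, inl v.st c = 0 → ∀ j i, TP Δ (v.nb c) j = some (v, i) → j = 1 := by
    intro c hc hi j i h
    obtain ⟨d, hd, rfl, e, -⟩ := (TP_eq _ _ _ _).1 h
    have := (rev v c hc).1
    rw [← e] at this
    have h2 := (rev v c hc).1
    have := nb_inj (v.nb c) hd (inl_lt (good hΔ v) hc) (e.trans h2.symm)
    omega
  refine ⟨Nd Δ, TG hΔ, TP Δ, v, v.nb 0, v.nb 1, fun z => (deg_TG hΔ z).le, TP_port hΔ,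
    ⟨0, h0, rfl⟩, ⟨1, h1, rfl⟩, hne, ?_⟩
  intro X x₀ A hA j i j' i' hj hj' r hr
  rw [out 0 h0 hi0 j i hj, out 1 h1 hi1 j' i' hj']
  have b0 := nbV hΔ v rfl 0 h0
  have b1 := nbV hΔ v rfl 1 h1
  have he : v.st.e = 0 := rfl
  rw [hi0, he] at b0
  rw [hi1, he] at b1
  rw [sim_run hΔ x₀ A hA r _ _ (main_sim hΔ r (v.nb 0) (v.nb 1) (by rw [nb_k, nb_k])
    (by omega) (by omega))]

end Paper
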